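/- arXiv:math/0210066 — 2 statements merged into one kernel-verified Lean document; each statement's English description precedes it below -/
import Mathlib

section
/- Let $k$ be a field of characteristic zero, $n \geq 2$ an integer, $p(x) \in k[x]$ an irreducible polynomial with $L = k[x]/(p(x))$, and suppose $c \in L^*$ is an element not lying in the subgroup $(L^*)^n k^*$ of $L^*$ (where $k^*$ is viewed inside $L^*$ via the inclusion $k \subset L$). Let $q(x) \in k[x]$ be a polynomial whose image in $L$ is $c$. Let $R = k[x,y,z]$, and let $M_1$ be the kernel of the $R$-linear map $R^{n+1} \to R$, $(b_0,\dots,b_n) \mapsto b_0 p^{n-1} + b_1 p^{n-2} y + \cdots + b_{n-1} y^{n-1} + b_n z$, and $M_2$ the kernel of the $R$-linear map $R^{n+1} \to R$ defined by the same formula with the last coefficient $z$ replaced by $qz$. Then $M_1$ and $M_2$ are reflexive $R$-modules of rank $n$ with $M_1 \oplus R \cong M_2 \oplus R$, but $M_1$ and $M_2$ are not isomorphic as $R$-modules. -/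
open TensorProduct MvPolynomial

/-- The polynomial ring `k[x,y,z]`. -/
abbrev R3 (k : Type) [Field k] : Type := MvPolynomial (Fin 3) k

/-- The linear form `Rⁿ⁺¹ → R` with coefficient vector `w`. -/
noncomputable def linForm (k : Type) [Field k] (n : ℕ) (w : Fin (n + 1) → R3 k) :
    (Fin (n + 1) → R3 k) →ₗ[R3 k] R3 k :=
  ∑ i, w i • LinearMap.proj i

/-- The coefficient vector `(pⁿ⁻¹, pⁿ⁻²y, …, yⁿ⁻¹, z)` (with last entry multiplied by
`q` when `qlast = some q`). -/
noncomputable def coeffVec (k : Type) [Field k] (n : ℕ) (p : Polynomial k)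
    (qlast : R3 k) : Fin (n + 1) → R3 k :=
  fun i => if (i : ℕ) < n
    then (Polynomial.aeval (X 0 : R3 k) p) ^ (n - 1 - (i : ℕ)) * (X 1) ^ (i : ℕ)
    else qlast * X 2


section gen
set_option linter.unusedSectionVars false
variable {R : Type} [CommRing R] [IsDomain R] {ι : Type} [Fintype ι] [DecidableEq ι]

theorem gen_mem (a : ι → R) (f : (ι → R) →ₗ[R] R) (hf : ∀ v, f v = ∑ i, a i * v i) (i : ι)
    (w : ι → R) : a i • w - f w • Pi.single i 1 ∈ LinearMap.ker f := by
  have h1 : f (Pi.single i 1) = a i := by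
    rw [hf]; simp [Pi.single_apply]
  rw [LinearMap.mem_ker, map_sub, map_smul, map_smul, h1]
  simp [mul_comm]

theorem gen_single (a : ι → R) (f : (ι → R) →ₗ[R] R) (hf : ∀ v, f v = ∑ i, a i * v i) (i : ι) :
    f (Pi.single i 1) = a i := by
    rw [hf]; simp [Pi.single_apply]

/-- If a form vanishes on the kernel after scaling -/
noncomputable def genG (a : ι → R) (f : (ι → R) →ₗ[R] R) (hf : ∀ v, f v = ∑ i, a i * v i) (i : ι)
    : (ι → R) →ₗ[R] LinearMap.ker f :=
  LinearMap.codRestrict (LinearMap.ker f)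
    (a i • LinearMap.id - f.smulRight (Pi.single i 1)) (fun w => by
      simpa using gen_mem a f hf i w)

theorem genG_coe (a : ι → R) (f : (ι → R) →ₗ[R] R) (hf : ∀ v, f v = ∑ i, a i * v i) (i : ι)
    (w : ι → R) : (genG a f hf i w : ι → R) = a i • w - f w • Pi.single i 1 := by
  simp [genG]

theorem genG_ker (a : ι → R) (f : (ι → R) →ₗ[R] R) (hf : ∀ v, f v = ∑ i, a i * v i) (i : ι)
    (w : LinearMap.ker f) : genG a f hf i w = a i • w := by
  apply Subtype.ext
  rw [genG_coe, show f w = 0 from w.2]; simp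

theorem gen_reflexive (a : ι → R) (f : (ι → R) →ₗ[R] R) (hf : ∀ v, f v = ∑ i, a i * v i) (i : ι)
    (hi : a i ≠ 0) : Module.IsReflexive R (LinearMap.ker f) := by
  constructor
  constructor
  · rw [injective_iff_map_eq_zero]
    intro v hv
    apply Subtype.ext
    funext j
    have := LinearMap.congr_fun hv ((LinearMap.proj j) ∘ₗ (LinearMap.ker f).subtype)
    simpa using this
  · intro ψ
    let m : ι → R := fun j => ψ ((LinearMap.proj j) ∘ₗ (LinearMap.ker f).subtype)
    have key : ∀ h : (ι → R) →ₗ[R] R, ψ (h ∘ₗ (LinearMap.ker f).subtype) = h m := by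
      intro h
      have : h ∘ₗ (LinearMap.ker f).subtype =
          ∑ j, h (Pi.single j 1) • ((LinearMap.proj j) ∘ₗ (LinearMap.ker f).subtype) := by
        ext v
        conv_lhs => rw [LinearMap.comp_apply, LinearMap.pi_apply_eq_sum_univ]
        simp [mul_comm, ← Pi.single_apply]
        refine Finset.sum_congr rfl fun j _ => ?_
        congr 2
        funext l; simp [Pi.single_apply, eq_comm]
      rw [this, map_sum, LinearMap.pi_apply_eq_sum_univ h m]
      refine Finset.sum_congr rfl fun j _ => ?_
      rw [map_smul, smul_eq_mul, smul_eq_mul, mul_comm]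
      congr 2
      funext l; simp [Pi.single_apply, eq_comm]
    have hm : m ∈ LinearMap.ker f := by
      rw [LinearMap.mem_ker, ← key]
      have : f ∘ₗ (LinearMap.ker f).subtype = 0 := by ext v; exact v.2
      rw [this, map_zero]
    refine ⟨⟨m, hm⟩, ?_⟩
    ext g
    apply mul_left_cancel₀ hi
    have h2 := key (g ∘ₗ genG a f hf i)
    have h3 : (g ∘ₗ genG a f hf i) ∘ₗ (LinearMap.ker f).subtype = a i • g := by
      ext v
      simp [genG_ker]
    rw [h3, map_smul] at h2
    have h4 := genG_ker a f hf i ⟨m, hm⟩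
    simp only [LinearMap.comp_apply] at h2
    rw [show genG a f hf i m = a i • ⟨m, hm⟩ from h4, map_smul] at h2
    exact h2.symm

theorem gen_rank (a : ι → R) (f : (ι → R) →ₗ[R] R) (hf : ∀ v, f v = ∑ i, a i * v i) (i : ι)
    (hi : a i ≠ 0) (n : ℕ) (hn : Fintype.card ι = n + 1) :
    Module.rank (FractionRing R) (FractionRing R ⊗[R] (LinearMap.ker f)) = n := by
  rw [IsLocalization.rank_eq (FractionRing R) (nonZeroDivisors R) le_rfl,
    IsLocalizedModule.rank_eq (nonZeroDivisors R) le_rfl (TensorProduct.mk R (FractionRing R) (LinearMap.ker f) 1)]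
  have h := f.quotKerEquivRange.rank_eq
  have h2 := rank_quotient_add_rank_of_isDomain (LinearMap.ker f)
  have h3 : Module.rank R (LinearMap.range f) = 1 := by
    apply le_antisymm
    · exact (Submodule.rank_le _).trans (by simp)
    · rw [Cardinal.one_le_iff_pos, rank_pos_iff_exists_ne_zero]
      exact ⟨⟨a i, ⟨_, gen_single a f hf i⟩⟩, fun h => hi (congrArg Subtype.val h)⟩
  rw [h, h3, rank_fun', hn] at h2
  push_cast at h2
  rw [add_comm] at h2
  exact Cardinal.eq_of_add_eq_add_right h2 Cardinal.one_lt_aleph0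

theorem gen_ext (a : ι → R) (f : (ι → R) →ₗ[R] R) (hf : ∀ v, f v = ∑ i, a i * v i) (i0 i1 i2 : ι)
    (h0 : a i0 ≠ 0) (h1 : ∀ w, a i0 ∣ a i1 * w → a i0 ∣ w)
    (h2 : ∀ w α β, a i2 * w = a i0 * α + a i1 * β → ∃ α' β', w = a i0 * α' + a i1 * β')
    (g : LinearMap.ker f →ₗ[R] R) :
    ∃ h : (ι → R) →ₗ[R] R, ∀ v, g v = h (v : ι → R) := by
  let G : ι → ι → R := fun i j => g (genG a f hf i (Pi.single j 1))
  have hG : ∀ i j k, a i * G j k + a j * G k i + a k * G i j = 0 := by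
    intro i j k
    simp only [G]
    rw [← smul_eq_mul, ← smul_eq_mul, ← smul_eq_mul, ← g.map_smul, ← g.map_smul, ← g.map_smul,
      ← g.map_add, ← g.map_add]
    convert map_zero g
    apply Subtype.ext
    simp only [Submodule.coe_add, Submodule.coe_smul, genG_coe, gen_single a f hf]
    simp only [smul_sub, smul_smul, Submodule.coe_zero]
    rw [mul_comm (a j) (a i), mul_comm (a k) (a i), mul_comm (a k) (a j)]
    abel
  have hGa : ∀ i j, G i j = - G j i := by
    intro i j
    simp only [G]
    rw [← map_neg]
    congr 1
    apply Subtype.ext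
    simp only [Submodule.coe_neg, genG_coe, gen_single a f hf]
    abel
  obtain ⟨s, t, hst⟩ := h2 (G i0 i1) (- G i1 i2) (- G i2 i0) (by
    linear_combination hG i0 i1 i2)
  -- h i1 = s, h i0 = -t
  have hd : ∀ j, a i0 ∣ G i0 j - a j * t := by
    intro j
    apply h1
    refine ⟨G i1 j + a j * s, ?_⟩
    linear_combination (-1) * hG i0 i1 j + a j * hst + a i1 * hGa i0 j
  choose H hH using hd
  refine ⟨Fintype.linearCombination R H, ?_⟩
  intro v
  apply mul_left_cancel₀ h0
  have e1 : a i0 * g v = g (genG a f hf i0 v) := by rw [genG_ker, map_smul]; rfl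
  have e2 : g (genG a f hf i0 v) = ∑ j, v.1 j * G i0 j := by
    have := LinearMap.pi_apply_eq_sum_univ (g ∘ₗ genG a f hf i0) v.1
    rw [LinearMap.comp_apply] at this
    rw [this]
    refine Finset.sum_congr rfl fun j _ => ?_
    simp only [smul_eq_mul, G, LinearMap.comp_apply]
    congr 3
    funext l; simp [Pi.single_apply, eq_comm]
  have e3 : f v.1 = 0 := v.2
  rw [e1, e2, Fintype.linearCombination_apply, Finset.mul_sum]
  rw [hf] at e3
  have : ∀ j, G i0 j = a j * t + a i0 * H j := fun j => by linear_combination hH j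
  calc _ = ∑ j, (t * (a j * v.1 j) + a i0 * (v.1 j • H j)) := by
        refine Finset.sum_congr rfl fun j _ => ?_
        rw [this, smul_eq_mul]; ring
    _ = _ := by rw [Finset.sum_add_distrib, ← Finset.mul_sum, e3]; simp

theorem gen_van (a : ι → R) (f : (ι → R) →ₗ[R] R) (hf : ∀ v, f v = ∑ i, a i * v i) (i0 i1 : ι)
    (h0 : a i0 ≠ 0) (h1 : ∀ w, a i0 ∣ a i1 * w → a i0 ∣ w)
    (h : (ι → R) →ₗ[R] R) (hv : ∀ v ∈ LinearMap.ker f, h v = 0) :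
    ∃ u : R, h = u • f := by
  have key : ∀ i v, a i * h v = f v * h (Pi.single i 1) := by
    intro i v
    have := hv _ (gen_mem a f hf i v)
    rw [map_sub, map_smul, map_smul] at this
    linear_combination this
  have k1 := key i0 (Pi.single i1 1)
  rw [gen_single a f hf] at k1
  obtain ⟨u, hu⟩ := h1 _ ⟨_, k1.symm⟩
  refine ⟨u, ?_⟩
  apply LinearMap.ext
  intro v
  apply mul_left_cancel₀ h0
  rw [key, hu]
  simp only [LinearMap.smul_apply, smul_eq_mul]; ring

theorem gen_extmap (a : ι → R) (f f' : (ι → R) →ₗ[R] R) (hf : ∀ v, f v = ∑ i, a i * v i)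
    (i0 i1 i2 : ι)
    (h0 : a i0 ≠ 0) (h1 : ∀ w, a i0 ∣ a i1 * w → a i0 ∣ w)
    (h2 : ∀ w α β, a i2 * w = a i0 * α + a i1 * β → ∃ α' β', w = a i0 * α' + a i1 * β')
    (e : LinearMap.ker f →ₗ[R] LinearMap.ker f') :
    ∃ (A : (ι → R) →ₗ[R] (ι → R)) (u : R), (∀ v : LinearMap.ker f, A v = e v) ∧
      ∀ v, f' (A v) = u * f v := by
  have := fun i => gen_ext a f hf i0 i1 i2 h0 h1 h2
    (LinearMap.proj i ∘ₗ (LinearMap.ker f').subtype ∘ₗ e)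
  choose h hh using this
  have hA : ∀ v : LinearMap.ker f, LinearMap.pi h v = (e v : ι → R) := by
    intro v; funext i
    exact (hh i v).symm
  obtain ⟨u, hu⟩ := gen_van a f hf i0 i1 h0 h1 (f' ∘ₗ LinearMap.pi h) (by
    intro v hv
    rw [LinearMap.comp_apply, hA ⟨v, hv⟩]
    exact (e ⟨v, hv⟩).2)
  exact ⟨LinearMap.pi h, u, hA, fun v => LinearMap.congr_fun hu v⟩

theorem gen_dvd_det (b : ι → R) (f f' : (ι → R) →ₗ[R] R) (hf' : ∀ v, f' v = ∑ i, b i * v i)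
    (i0 i1 : ι) (h0 : b i0 ≠ 0) (h1 : ∀ w, b i0 ∣ b i1 * w → b i0 ∣ w)
    (A : (ι → R) →ₗ[R] (ι → R)) (u : R) (hA : ∀ v, f' (A v) = u * f v) :
    ∃ κ, LinearMap.det A = u * κ := by
  have key : ∀ i, ∃ w, b i * LinearMap.det A = u * w := by
    intro i
    refine ⟨f ((LinearMap.toMatrix' A).adjugate.mulVec (Pi.single i 1)), ?_⟩
    rw [← hA, ← LinearMap.toMatrix'_mulVec A, Matrix.mulVec_mulVec, Matrix.mul_adjugate,
      LinearMap.det_toMatrix', Matrix.smul_mulVec, Matrix.one_mulVec, map_smul,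
      gen_single b f' hf', smul_eq_mul, mul_comm]
  obtain ⟨w0, e0⟩ := key i0
  obtain ⟨w1, e1⟩ := key i1
  by_cases hu : u = 0
  · refine ⟨0, ?_⟩
    rw [hu, zero_mul] at e0
    rw [mul_zero]; exact (mul_eq_zero.mp e0).resolve_left h0
  obtain ⟨κ, hκ⟩ := h1 w0 ⟨w1, mul_left_cancel₀ hu (by
    linear_combination b i0 * e1 - b i1 * e0)⟩
  refine ⟨κ, mul_left_cancel₀ h0 ?_⟩
  rw [e0, hκ]; ring

theorem gen_det_one_add (f : (ι → R) →ₗ[R] R) (l : ι → R) (T : (ι → R) →ₗ[R] (ι → R))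
    (hT : ∀ v, T v = v + f v • l) : LinearMap.det T = 1 + f l := by
  have : LinearMap.toMatrix' T = 1 + Matrix.vecMulVec l (fun j => f (Pi.single j 1)) := by
    ext i j
    rw [LinearMap.toMatrix'_apply]
    simp [hT, Matrix.vecMulVec_apply, Matrix.one_apply, Pi.single_apply, mul_comm]
  rw [← LinearMap.det_toMatrix', this, Matrix.vecMulVec_eq Unit,
    Matrix.det_one_add_replicateCol_mul_replicateRow]
  congr 1
  rw [LinearMap.pi_apply_eq_sum_univ f l]
  simp only [dotProduct]
  refine Finset.sum_congr rfl fun j _ => ?_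
  rw [smul_eq_mul, mul_comm]
  congr 2
  funext l; simp [Pi.single_apply, eq_comm]

theorem gen_main {L : Type} [CommRing L] (ε : R →+* L) [Nontrivial L] (a b d : ι → R)
    (f f' : (ι → R) →ₗ[R] R)
    (hf : ∀ v, f v = ∑ i, a i * v i) (hf' : ∀ v, f' v = ∑ i, b i * v i)
    (i0 i1 i2 : ι)
    (h0 : a i0 ≠ 0) (h1 : ∀ w, a i0 ∣ a i1 * w → a i0 ∣ w)
    (h2 : ∀ w α β, a i2 * w = a i0 * α + a i1 * β → ∃ α' β', w = a i0 * α' + a i1 * β')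
    (k0 : b i0 ≠ 0) (k1 : ∀ w, b i0 ∣ b i1 * w → b i0 ∣ w)
    (k2 : ∀ w α β, b i2 * w = b i0 * α + b i1 * β → ∃ α' β', w = b i0 * α' + b i1 * β')
    (e : LinearMap.ker f ≃ₗ[R] LinearMap.ker f')
    (hd : ∀ i, b i = a i * d i) (hεa : ∀ i, ε (a i) = 0)
    (hε : ∀ v ∈ LinearMap.ker f, ∀ i, ε (v i) = 0) (n : ℕ) (hn : Fintype.card ι = n + 1) :
    ∃ u κ, IsUnit κ ∧ IsUnit (ε u) ∧ (∏ i, ε (d i)) * ε κ = ε u ^ n := by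
  obtain ⟨A, u, hA, hu⟩ := gen_extmap a f f' hf i0 i1 i2 h0 h1 h2 e.toLinearMap
  obtain ⟨B, u', hB, hu'⟩ := gen_extmap b f' f hf' i0 i1 i2 k0 k1 k2 e.symm.toLinearMap
  obtain ⟨κ, hκ⟩ := gen_dvd_det b f f' hf' i0 i1 k0 k1 A u hu
  obtain ⟨κ', hκ'⟩ := gen_dvd_det a f' f hf i0 i1 h0 h1 B u' hu'
  have hl := fun i => gen_van a f hf i0 i1 h0 h1 (LinearMap.proj i ∘ₗ (B ∘ₗ A - LinearMap.id)) (by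
    intro v hv
    have e1 := hA ⟨v, hv⟩
    have e2 := hB (e ⟨v, hv⟩)
    simp only [LinearEquiv.coe_coe, LinearEquiv.symm_apply_apply] at e1 e2
    simp [e1, e2])
  choose l hl using hl
  have hBA : ∀ v, (B ∘ₗ A) v = v + f v • l := by
    intro v; funext i
    have := LinearMap.congr_fun (hl i) v
    simp at this
    simp
    linear_combination this
  have hdet := gen_det_one_add f l _ hBA
  have huu : u * u' = 1 + f l := by
    apply mul_left_cancel₀ h0
    have e1 := hu' (A (Pi.single i0 1))
    rw [hu, ← LinearMap.comp_apply B A, hBA, map_add, map_smul, gen_single a f hf, smul_eq_mul] at e1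
    linear_combination -e1
  have hεu : ε u * ε u' = 1 := by
    rw [← map_mul, huu, hf]
    simp [hεa]
  have huu0 : u * u' ≠ 0 := by
    intro h
    rw [← map_mul, h, map_zero] at hεu
    exact zero_ne_one hεu
  rw [LinearMap.det_comp, hκ, hκ', ← huu] at hdet
  have hκκ : κ * κ' = 1 := mul_left_cancel₀ huu0 (by linear_combination hdet)
  have hεU : IsUnit (ε u) := IsUnit.of_mul_eq_one _ hεu
  refine ⟨u, κ, IsUnit.of_mul_eq_one _ hκκ, hεU, ?_⟩
  have hmat : (Matrix.diagonal d * LinearMap.toMatrix' A).map ε = (ε u) • (1 : Matrix ι ι L) := by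
    ext i j
    have hv : (fun i => d i * (LinearMap.toMatrix' A) i j - u * (1 : Matrix ι ι R) i j) ∈
        LinearMap.ker f := by
      rw [LinearMap.mem_ker, hf]
      have e1 := hu (Pi.single j 1)
      rw [gen_single a f hf, hf'] at e1
      simp only [mul_sub, Finset.sum_sub_distrib, LinearMap.toMatrix'_apply]
      simp only [hd] at e1
      simp only [← mul_assoc]
      rw [e1]
      simp [Matrix.one_apply, mul_comm]
    have := hε _ hv i
    simp only [map_sub, map_mul, sub_eq_zero] at this
    rw [Matrix.map_apply, Matrix.diagonal_mul, map_mul, this]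
    simp [Matrix.one_apply, apply_ite ε]
  have hdet2 := congrArg Matrix.det hmat
  rw [Matrix.det_smul, Matrix.det_one, ← RingHom.mapMatrix_apply, ← RingHom.map_det,
    Matrix.det_mul, Matrix.det_diagonal, LinearMap.det_toMatrix', hκ, hn] at hdet2
  apply hεU.mul_left_cancel
  simp only [map_mul, map_prod] at hdet2
  rw [pow_succ] at hdet2
  linear_combination hdet2

theorem gen_stable (a b : ι → R) (f f' : (ι → R) →ₗ[R] R)
    (hf : ∀ v, f v = ∑ i, a i * v i) (hf' : ∀ v, f' v = ∑ i, b i * v i)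
    (i0 i2 : ι) (h02 : i0 ≠ i2) (q s t : R) (hst : s * a i0 + t * q = 1)
    (hb : ∀ i, i ≠ i2 → b i = a i) (hb2 : b i2 = q * a i2) :
    Nonempty ((LinearMap.ker f × R) ≃ₗ[R] (LinearMap.ker f' × R)) := by
  have hff : ∀ v, f' v = f v + (q - 1) * a i2 * v i2 := by
    intro v
    rw [hf, hf', ← Finset.sum_erase_add Finset.univ (fun i => b i * v i) (Finset.mem_univ i2),
      ← Finset.sum_erase_add Finset.univ (fun i => a i * v i) (Finset.mem_univ i2), hb2,
      Finset.sum_congr rfl fun i hi => by rw [hb i (Finset.ne_of_mem_erase hi)]]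
    ring
  have s0 : f' (Pi.single i0 1) = a i0 := by rw [gen_single b f' hf', hb _ h02]
  have s2 : f' (Pi.single i2 1) = q * a i2 := by rw [gen_single b f' hf', hb2]
  have t0 : f (Pi.single i0 1) = a i0 := gen_single a f hf _
  have t2 : f (Pi.single i2 1) = a i2 := gen_single a f hf _
  let T : LinearMap.ker f × R →ₗ[R] LinearMap.ker f' × R :=
    { toFun := fun x => (⟨x.1.1 + (a i2 * (s * x.1.1 i2 + q * x.2)) • Pi.single i0 1
          + (t * x.1.1 i2 - a i0 * x.2 - x.1.1 i2) • Pi.single i2 1, by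
          have : f x.1.1 = 0 := x.1.2
          rw [LinearMap.mem_ker, map_add, map_add, map_smul, map_smul, s0, s2, hff, this]
          simp only [smul_eq_mul]
          linear_combination a i2 * x.1.1 i2 * hst⟩, s * x.1.1 i2 + q * x.2)
      map_add' := by
        intro x y
        refine Prod.ext (Subtype.ext (funext fun j => ?_)) ?_
        · simp; ring
        · simp; ring
      map_smul' := by
        intro c x
        refine Prod.ext (Subtype.ext (funext fun j => ?_)) ?_
        · simp; ring
        · simp; ring }
  let S : LinearMap.ker f' × R →ₗ[R] LinearMap.ker f × R :=
    { toFun := fun x => (⟨x.1.1 + (-(a i2 * x.2)) • Pi.single i0 1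
          + (q * x.1.1 i2 + a i0 * x.2 - x.1.1 i2) • Pi.single i2 1, by
          have : f' x.1.1 = 0 := x.1.2
          rw [hff] at this
          rw [LinearMap.mem_ker, map_add, map_add, map_smul, map_smul, t0, t2]
          simp only [smul_eq_mul]
          linear_combination this⟩, - s * x.1.1 i2 + t * x.2)
      map_add' := by
        intro x y
        refine Prod.ext (Subtype.ext (funext fun j => ?_)) ?_
        · simp; ring
        · simp; ring
      map_smul' := by
        intro c x
        refine Prod.ext (Subtype.ext (funext fun j => ?_)) ?_
        · simp; ring
        · simp; ring }
  refine ⟨LinearEquiv.ofLinearMap T S ?_ ?_⟩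
  · apply LinearMap.ext
    intro x
    refine Prod.ext (Subtype.ext (funext fun j => ?_)) ?_
    · by_cases j0 : j = i0
      · subst j0
        simp [T, S, h02, h02.symm]
        linear_combination a i2 * x.2 * hst
      by_cases j2 : j = i2
      · subst j2
        simp [T, S, h02, h02.symm]
        linear_combination x.1.1 j * hst
      simp [T, S, j0, j2, Pi.single_apply]
    · simp [T, S, h02, h02.symm, Pi.single_apply]
      linear_combination x.2 * hst
  · apply LinearMap.ext
    intro x
    refine Prod.ext (Subtype.ext (funext fun j => ?_)) ?_
    · by_cases j0 : j = i0
      · subst j0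
        simp [T, S, h02, h02.symm]
      by_cases j2 : j = i2
      · subst j2
        simp [T, S, h02, h02.symm]
        linear_combination x.1.1 j * hst
      simp [T, S, j0, j2, Pi.single_apply]
    · simp [T, S, h02, h02.symm, Pi.single_apply]
      linear_combination x.2 * hst
end gen

section conc
variable {k : Type} [Field k]

noncomputable def sig (i : Fin 3) : R3 k →ₐ[k] R3 k :=
  aeval (fun j => if j = i then 0 else X j)

theorem sig_X_self (i : Fin 3) : sig i (X i : R3 k) = 0 := by simp [sig]

theorem sig_X_ne (i j : Fin 3) (h : j ≠ i) : sig i (X j : R3 k) = X j := by simp [sig, h]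

theorem sig_pol (i : Fin 3) (h : 0 ≠ i) (p : Polynomial k) :
    sig i (Polynomial.aeval (X 0 : R3 k) p) = Polynomial.aeval (X 0 : R3 k) p := by
  rw [← Polynomial.aeval_algHom_apply, sig_X_ne i 0 h]

theorem dvd_sub_sig (i : Fin 3) (f : R3 k) : (X i : R3 k) ∣ f - sig i f := by
  induction f using MvPolynomial.induction_on with
  | C a => simp [sig]
  | add p q hp hq =>
    rw [map_add, add_sub_add_comm]; exact dvd_add hp hq
  | mul_X p j hp =>
    rw [map_mul]
    by_cases h : j = i
    · subst h; rw [sig_X_self]; simp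
    · rw [sig_X_ne i j h, ← sub_mul]; exact hp.mul_right _

theorem dvd_of_sig (i : Fin 3) (f : R3 k) (h : sig i f = 0) : (X i : R3 k) ∣ f := by
  simpa [h] using dvd_sub_sig i f

theorem reg2_one (P w : R3 k) (h0 : P ≠ 0) (hP : sig 1 P = P) (h : P ∣ X 1 * w) : P ∣ w := by
  obtain ⟨α, hα⟩ := h
  have e := congrArg (sig 1) hα
  rw [map_mul, map_mul, sig_X_self, zero_mul, hP] at e
  obtain ⟨β, rfl⟩ := dvd_of_sig 1 α ((mul_eq_zero.mp e.symm).resolve_left h0)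
  exact ⟨β, mul_left_cancel₀ (X_ne_zero 1) (by rw [hα]; ring)⟩

theorem reg2 (P : R3 k) (h0 : P ≠ 0) (hP : sig 1 P = P) (m : ℕ) (w : R3 k)
    (h : P ∣ X 1 ^ m * w) : P ∣ w := by
  induction m with
  | zero => simpa using h
  | succ m ih =>
    apply ih
    apply reg2_one P _ h0 hP
    rwa [pow_succ', mul_assoc] at h

theorem reg3 (P Y w α β : R3 k) (hP : sig 2 P = P) (hY : sig 2 Y = Y)
    (h : X 2 * w = P * α + Y * β) : ∃ α' β', w = P * α' + Y * β' := by
  obtain ⟨α', hα⟩ := dvd_sub_sig 2 α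
  obtain ⟨β', hβ⟩ := dvd_sub_sig 2 β
  have e := congrArg (sig 2) h
  simp only [map_mul, map_add, sig_X_self, zero_mul, hP, hY] at e
  refine ⟨α', β', mul_left_cancel₀ (X_ne_zero 2) ?_⟩
  linear_combination h - e + P * hα + Y * hβ

variable {L : Type} [CommRing L]

theorem min_gen (ε : R3 k →+* L) (P : R3 k) (h0 : P ≠ 0) (hP : sig 1 P = P) (hεP : ε P = 0)
    (hεy : ε (X 1) = 0) (N : ℕ) : ∀ v : ℕ → R3 k,
    ∑ i ∈ Finset.range (N + 1), P ^ (N - i) * X 1 ^ i * v i = 0 → ∀ i ≤ N, ε (v i) = 0 := by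
  induction N with
  | zero =>
    intro v hv i hi
    obtain rfl : i = 0 := by omega
    simp at hv
    rw [hv, map_zero]
  | succ N ih =>
    intro v hv
    have e := congrArg (sig 1) hv
    rw [Finset.sum_range_succ'] at hv e
    simp only [map_add, map_sum, map_mul, map_pow, sig_X_self, hP, map_zero] at e
    have e' : sig 1 (v 0) = 0 := by
      simpa [h0] using e
    obtain ⟨w, hw⟩ := dvd_of_sig 1 _ e'
    have key := ih (fun i => v (i + 1) + if i = 0 then P * w else 0) (by
      apply mul_left_cancel₀ (X_ne_zero (R := k) (1 : Fin 3))
      rw [mul_zero]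
      refine Eq.trans ?_ hv
      rw [hw]
      simp only [mul_add, Finset.sum_add_distrib, Finset.mul_sum]
      congr 1
      · refine Finset.sum_congr rfl fun i _ => ?_
        rw [Nat.add_sub_add_right]; ring
      · rw [Finset.sum_eq_single 0]
        · simp; ring
        · intro i _ hi; simp [hi]
        · simp)
    intro i hi
    rcases i with _ | i
    · rw [hw, map_mul, hεy, zero_mul]
    · have := key i (by omega)
      rw [map_add] at this
      split_ifs at this <;> simpa [hεP] using this

theorem linForm_apply' (n : ℕ) (w v : Fin (n + 1) → R3 k) :
    linForm k n w v = ∑ i, w i * v i := by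
  simp [linForm, LinearMap.sum_apply]

theorem min_full (ε : R3 k →+* L) (p : Polynomial k) (h0 : p ≠ 0)
    (hεP : ε (Polynomial.aeval (X 0) p) = 0)
    (hεy : ε (X 1) = 0) (hεz : ε (X 2) = 0) (N : ℕ) (hN : 1 ≤ N)
    (v : Fin (N + 1 + 1) → R3 k)
    (hv : v ∈ LinearMap.ker (linForm k (N + 1) (coeffVec k (N + 1) p 1))) (i) : ε (v i) = 0 := by
  have hP0 : Polynomial.aeval (X 0 : R3 k) p ≠ 0 := by
    intro h
    apply h0
    have := congrArg (aeval (fun _ => (Polynomial.X : Polynomial k))) h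
    rw [← Polynomial.aeval_algHom_apply] at this
    simpa using this
  have hsε : ∀ f, ε (sig 2 f) = ε f := by
    intro f
    obtain ⟨g, hg⟩ := dvd_sub_sig 2 f
    have := congrArg ε hg
    rw [map_sub, map_mul, hεz, zero_mul, sub_eq_zero] at this
    exact this.symm
  rw [LinearMap.mem_ker, linForm_apply', Fin.sum_univ_castSucc] at hv
  simp only [coeffVec, Fin.val_castSucc, Fin.is_lt, if_true, Fin.val_last, lt_irrefl, if_false,
    one_mul, Nat.add_sub_cancel] at hv
  set P := Polynomial.aeval (X 0 : R3 k) p with hP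
  refine Fin.lastCases ?_ (fun i => ?_) i
  · have hmem : (∑ i : Fin (N + 1), P ^ (N - i : ℕ) * X 1 ^ (i : ℕ) * v i.castSucc) ∈
        Ideal.span {P, X 1} := by
      refine Ideal.sum_mem _ fun i _ => Ideal.mul_mem_right _ _ ?_
      by_cases hi : (i : ℕ) = 0
      · rw [hi]
        exact Ideal.mul_mem_right _ _ (Ideal.pow_mem_of_mem _ (Ideal.subset_span (by simp)) _ (by omega))
      · exact Ideal.mul_mem_left _ _ (Ideal.pow_mem_of_mem _ (Ideal.subset_span (by simp)) _ (by omega))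
    obtain ⟨α, β, hαβ⟩ := Ideal.mem_span_pair.mp hmem
    obtain ⟨α', β', h⟩ := reg3 P (X 1) (v (Fin.last _)) (-α) (-β) (sig_pol 2 (by decide) p)
      (sig_X_ne 2 1 (by decide)) (by linear_combination hv + hαβ)
    rw [h]; simp [hεP, hεy]
  · have e := congrArg (sig 2) hv
    have hsP : sig 2 P = P := sig_pol 2 (by decide) p
    simp only [map_add, map_sum, map_mul, map_pow, sig_X_self, hsP, map_zero, zero_mul, add_zero,
      sig_X_ne 2 1 (by decide)] at e
    have := min_gen ε P hP0 (sig_pol 1 (by decide) p) hεP hεy N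
      (fun j => if h : j < N + 1 then sig 2 (v (Fin.castSucc ⟨j, h⟩)) else 0) (by
        rw [Finset.sum_range]
        refine Eq.trans (Finset.sum_congr rfl fun i _ => ?_) e
        rw [dif_pos i.2]) i (by omega)
    rw [dif_pos i.2, hsε] at this
    exact this

end conc

/-- **Characteristic-zero three-variable examples.**  Let `k` be a field of
characteristic zero, `n ≥ 2`, `p ∈ k[x]` irreducible with `L = k[x]/(p)`, and
`c ∈ L^* \ (L^*)ⁿk^*`, with `q ∈ k[x]` mapping to `c`.  Over `R = k[x,y,z]`, the kernels
`M₁`, `M₂` of the forms with coefficient vectors `(pⁿ⁻¹, pⁿ⁻²y, …, yⁿ⁻¹, z)` and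
`(pⁿ⁻¹, pⁿ⁻²y, …, yⁿ⁻¹, qz)` are reflexive `R`-modules of rank `n`, stably isomorphic
but not isomorphic. -/
theorem char_zero_noncancellation (k : Type) [Field k] [CharZero k]
    (n : ℕ) (hn : 2 ≤ n)
    (p : Polynomial k) (hirr : Irreducible p)
    (c : Polynomial k ⧸ Ideal.span {p}) (hcu : IsUnit c)
    (hc : ¬ ∃ (a : Polynomial k ⧸ Ideal.span {p}) (b : k), IsUnit a ∧ b ≠ 0 ∧
      c = a ^ n * algebraMap k (Polynomial k ⧸ Ideal.span {p}) b)
    (q : Polynomial k) (hq : Ideal.Quotient.mk (Ideal.span {p}) q = c) :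
    Module.IsReflexive (R3 k)
      (LinearMap.ker (linForm k n (coeffVec k n p (1 : R3 k)))) ∧
    Module.IsReflexive (R3 k)
      (LinearMap.ker (linForm k n (coeffVec k n p (Polynomial.aeval (X 0 : R3 k) q)))) ∧
    Module.rank (FractionRing (R3 k))
      (FractionRing (R3 k) ⊗[R3 k]
        (LinearMap.ker (linForm k n (coeffVec k n p (1 : R3 k))))) = n ∧
    Module.rank (FractionRing (R3 k))
      (FractionRing (R3 k) ⊗[R3 k]
        (LinearMap.ker (linForm k n
          (coeffVec k n p (Polynomial.aeval (X 0 : R3 k) q))))) = n ∧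
    Nonempty (((LinearMap.ker (linForm k n (coeffVec k n p (1 : R3 k)))) × R3 k)
      ≃ₗ[R3 k]
      ((LinearMap.ker (linForm k n
        (coeffVec k n p (Polynomial.aeval (X 0 : R3 k) q)))) × R3 k)) ∧
    IsEmpty ((LinearMap.ker (linForm k n (coeffVec k n p (1 : R3 k)))) ≃ₗ[R3 k]
      (LinearMap.ker (linForm k n
        (coeffVec k n p (Polynomial.aeval (X 0 : R3 k) q))))) := by
  obtain ⟨N, rfl⟩ : ∃ N, n = N + 1 := ⟨n - 1, by omega⟩
  have hN : 1 ≤ N := by omega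
  set P := Polynomial.aeval (X 0 : R3 k) p with hP
  set Q := Polynomial.aeval (X 0 : R3 k) q with hQ
  have hP0 : P ≠ 0 := by
    intro h
    apply hirr.ne_zero
    have := congrArg (aeval (fun _ => (Polynomial.X : Polynomial k))) h
    rw [hP, ← Polynomial.aeval_algHom_apply] at this
    simpa using this
  have hcop : IsCoprime p q := by
    rw [hirr.coprime_iff_not_dvd]
    intro h
    rw [← Ideal.mem_span_singleton, ← Ideal.Quotient.eq_zero_iff_mem, hq] at h
    have : Fact (Irreducible p) := ⟨hirr⟩
    have hmax : (Ideal.span {p}).IsMaximal := PrincipalIdealRing.isMaximal_of_irreducible hirr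
    have := Ideal.Quotient.nontrivial_iff.mpr hmax.ne_top
    exact hcu.ne_zero h
  obtain ⟨s, t, hst⟩ : IsCoprime (P ^ N) Q := by
    have := (hcop.map (Polynomial.aeval (X 0 : R3 k)).toRingHom)
    exact this.pow_left
  let i0 : Fin (N + 1 + 1) := 0
  let i1 : Fin (N + 1 + 1) := (Fin.last N).castSucc
  let i2 : Fin (N + 1 + 1) := Fin.last (N + 1)
  have v0 : ∀ r, coeffVec k (N + 1) p r i0 = P ^ N := by intro r; simp [coeffVec, i0, hP]
  have v1 : ∀ r, coeffVec k (N + 1) p r i1 = X 1 ^ N := by intro r; simp [coeffVec, i1]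
  have v2 : ∀ r, coeffVec k (N + 1) p r i2 = r * X 2 := by intro r; simp [coeffVec, i2]
  have hne : ∀ r, coeffVec k (N + 1) p r i0 ≠ 0 := by
    intro r; rw [v0]; exact pow_ne_zero _ hP0
  have hsP1 : sig 1 (P ^ N) = P ^ N := by rw [map_pow, sig_pol 1 (by decide) p]
  have hsP2 : sig 2 (P ^ N) = P ^ N := by rw [map_pow, sig_pol 2 (by decide) p]
  have hsY2 : sig 2 (X 1 ^ N : R3 k) = X 1 ^ N := by rw [map_pow, sig_X_ne 2 1 (by decide)]
  have hr2 : ∀ r w, coeffVec k (N + 1) p r i0 ∣ coeffVec k (N + 1) p r i1 * w →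
      coeffVec k (N + 1) p r i0 ∣ w := by
    intro r w
    rw [v0, v1]
    exact reg2 _ (pow_ne_zero _ hP0) hsP1 N w
  have hl := fun r => linForm_apply' (k := k) (N + 1) (coeffVec k (N + 1) p r)
  refine ⟨gen_reflexive _ _ (hl 1) i0 (hne 1), gen_reflexive _ _ (hl Q) i0 (hne Q),
    gen_rank _ _ (hl 1) i0 (hne 1) _ (by simp), gen_rank _ _ (hl Q) i0 (hne Q) _ (by simp), ?_, ?_⟩
  · refine gen_stable _ _ _ _ (hl 1) (hl Q) i0 i2 ?_ Q s t ?_ ?_ ?_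
    · simp [i0, i2, Fin.ext_iff]
    · rw [v0, hst]
    · intro i hi
      have : (i : ℕ) < N + 1 := by
        have := Fin.val_lt_last hi
        simpa using this
      simp [coeffVec, this]
    · rw [v2, v2, one_mul]
  · refine ⟨fun e => hc ?_⟩
    have hmax : (Ideal.span {p}).IsMaximal := PrincipalIdealRing.isMaximal_of_irreducible hirr
    have hnt := Ideal.Quotient.nontrivial_iff.mpr hmax.ne_top
    let ε : R3 k →ₐ[k] (Polynomial k ⧸ Ideal.span {p}) :=
      aeval ![Ideal.Quotient.mk (Ideal.span {p}) Polynomial.X, 0, 0]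
    have hεpol : ∀ r : Polynomial k, ε (Polynomial.aeval (X 0) r) =
        Ideal.Quotient.mk (Ideal.span {p}) r := by
      intro r
      rw [← Polynomial.aeval_algHom_apply]
      have : ε (X 0) = Ideal.Quotient.mkₐ k (Ideal.span {p}) Polynomial.X := by simp [ε]
      rw [this, Polynomial.aeval_algHom_apply, Polynomial.aeval_X_left_apply]
      rfl
    have hεP : ε P = 0 := by
      rw [hP, hεpol, Ideal.Quotient.eq_zero_iff_mem]; exact Ideal.mem_span_singleton_self p
    have hεy : ε (X 1) = 0 := by simp [ε]
    have hεz : ε (X 2) = 0 := by simp [ε]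
    obtain ⟨u, κ, hκ, hu, h⟩ := gen_main (ε : R3 k →+* (Polynomial k ⧸ Ideal.span {p}))
      (coeffVec k (N + 1) p 1) (coeffVec k (N + 1) p Q)
      (fun i => if (i : ℕ) < N + 1 then 1 else Q) _ _ (hl 1) (hl Q) i0 i1 i2
      (hne 1) (hr2 1) (by
        intro w α β
        rw [v0, v1, v2, one_mul]
        exact reg3 _ _ w α β hsP2 hsY2)
      (hne Q) (hr2 Q) (by
        intro w α β
        rw [v0, v1, v2]
        intro h
        obtain ⟨α', β', h'⟩ := reg3 _ _ w (t * α + s * (X 2 * w)) (t * β) hsP2 hsY2 (by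
          linear_combination t * h - X 2 * w * hst)
        exact ⟨α', β', h'⟩) e (by
        intro i
        simp only [coeffVec]
        split_ifs <;> ring) (by
        intro i
        simp only [coeffVec]
        split_ifs with hi
        · by_cases h0 : (i : ℕ) = 0
          · have : N + 1 - 1 - (i : ℕ) ≠ 0 := by omega
            rw [← hP, map_mul, map_pow, RingHom.coe_coe, hεP, zero_pow this, zero_mul]
          · simp [hεy, h0]
        · simp [hεz]) (by
        intro v hv i
        exact min_full _ p hirr.ne_zero hεP hεy hεz N hN v hv i) (N + 1) (by simp)
    rw [Fin.prod_univ_castSucc] at h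
    have hprod : ∏ i : Fin (N + 1), (ε : R3 k →+* (Polynomial k ⧸ Ideal.span {p}))
        (if ((i.castSucc : Fin (N + 1 + 1)) : ℕ) < N + 1 then 1 else Q) = 1 := by
      refine Finset.prod_eq_one fun i _ => ?_
      rw [if_pos (by rw [Fin.val_castSucc]; exact i.2), map_one]
    rw [hprod, one_mul, if_neg (by simp)] at h
    simp only [RingHom.coe_coe] at h
    rw [hQ, hεpol, hq] at h
    rw [isUnit_iff_eq_C_of_isReduced] at hκ
    obtain ⟨b, hb, rfl⟩ := hκ
    refine ⟨ε u, b⁻¹, hu, inv_ne_zero hb.ne_zero, ?_⟩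
    have hεC : ε (C b) = algebraMap k _ b := by simp [ε]
    rw [hεC] at h
    rw [← h, mul_assoc, ← map_mul, mul_inv_cancel₀ hb.ne_zero, map_one, mul_one]
end

section
/- Let $n \geq 2$ be an integer, let $\theta$ be the real $n$-th root of $2$, and let $L = \mathbb{Q}(\theta)$. Then $\theta$ does not belong to $(\mathbb{L}^*)^n \mathbb{Q}^*$; that is, there do not exist $a \in L^*$ and $b \in \mathbb{Q}^*$ with $\theta = a^n b$. In particular, $(L^*)^n \mathbb{Q}^* \neq L^*$. -/
open Polynomial in
lemma aux_irred (n : ℕ) (hn : 2 ≤ n) : Irreducible (X ^ n - C 2 : ℚ[X]) := by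
  have hm : (X ^ n - C 2 : ℤ[X]).Monic := monic_X_pow_sub_C 2 (by omega)
  have hd : (X ^ n - C 2 : ℤ[X]).natDegree = n := natDegree_X_pow_sub_C
  have hp : Prime (2 : ℤ) := Int.prime_two
  have hE : (X ^ n - C 2 : ℤ[X]).IsEisensteinAt (Ideal.span {(2 : ℤ)}) := by
    refine ⟨?_, ?_, ?_⟩
    · rw [hm.leadingCoeff, Ideal.mem_span_singleton]
      norm_num
    · intro k hk
      rw [hd] at hk
      rw [Ideal.mem_span_singleton, coeff_sub, coeff_X_pow, coeff_C, if_neg (by omega)]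
      split_ifs <;> simp
    · rw [Ideal.span_singleton_pow, Ideal.mem_span_singleton, coeff_sub, coeff_X_pow, coeff_C,
        if_neg (by omega)]
      norm_num
  have hI : Irreducible (X ^ n - C 2 : ℤ[X]) :=
    hE.irreducible ((Ideal.span_singleton_prime (by norm_num)).2 hp) hm.isPrimitive
      (by rw [hd]; omega)
  have := (Polynomial.IsPrimitive.Int.irreducible_iff_irreducible_map_cast hm.isPrimitive).1 hI
  have h2 : (C 2 : ℚ[X]) = 2 := rfl
  rw [h2]
  simpa using this

lemma aux_norm {K E : Type*} [Field K] [Field E] [Algebra K E] (n : ℕ) (hn : 2 ≤ n) (θ : E)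
    (hi : IsIntegral K θ)
    (hm : minpoly K θ = (Polynomial.X ^ n - Polynomial.C 2 : Polynomial K))
    (a : IntermediateField.adjoin K {θ}) (b : K)
    (h : a ^ n * algebraMap K (IntermediateField.adjoin K {θ}) b =
      IntermediateField.AdjoinSimple.gen K θ) : ∃ q : K, q ^ n = (-1) ^ n * (0 - 2) := by
  have hfr : Module.finrank K (IntermediateField.adjoin K {θ}) = n := by
    rw [IntermediateField.adjoin.finrank hi, hm, Polynomial.natDegree_X_pow_sub_C]
  have hN := Algebra.PowerBasis.norm_gen_eq_coeff_zero_minpoly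
    (IntermediateField.adjoin.powerBasis hi)
  rw [← PowerBasis.finrank, IntermediateField.adjoin.powerBasis_gen,
    IntermediateField.minpoly_gen, hm, ← h, map_mul,
    map_pow, Algebra.norm_algebraMap, hfr, ← mul_pow] at hN
  simp only [Polynomial.coeff_sub, Polynomial.coeff_X_pow, Polynomial.coeff_C] at hN
  rw [if_neg (by omega), if_pos trivial] at hN
  exact ⟨_, hN⟩

lemma aux_main (n : ℕ) (hn : 2 ≤ n) (θ : ℝ) (hθ : θ ^ n = 2)
    (a : IntermediateField.adjoin ℚ {θ}) (b : ℚ) :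
    a ^ n * algebraMap ℚ (IntermediateField.adjoin ℚ {θ}) b ≠
      IntermediateField.AdjoinSimple.gen ℚ θ := by
  intro h
  have hm : minpoly ℚ θ = (Polynomial.X ^ n - Polynomial.C 2 : Polynomial ℚ) :=
    (minpoly.eq_of_irreducible_of_monic (aux_irred n hn) (by simp [hθ])
      (Polynomial.monic_X_pow_sub_C 2 (by omega))).symm
  have hi : IsIntegral ℚ θ := ⟨_, Polynomial.monic_X_pow_sub_C 2 (by omega : n ≠ 0), by simp [hθ]⟩
  obtain ⟨q, hN⟩ := aux_norm n hn θ hi hm a b (by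
    rw [← h, eq_ratCast, eq_ratCast])
  have hN' : (q ^ 2) ^ n = 2 ^ 2 := by
    rw [← pow_mul, mul_comm, pow_mul, hN, mul_pow, ← pow_mul, mul_comm _ 2, pow_mul]
    norm_num
  have hv := congrArg (padicValRat 2) hN'
  have hq : q ≠ 0 := by
    rintro h0
    rw [h0] at hN'
    simp [show n ≠ 0 by omega] at hN'
    norm_num at hN'
  have h2 : padicValRat 2 (2 : ℚ) = 1 := by
    simpa using padicValRat.self (p := 2) (by norm_num)
  rw [padicValRat.pow, padicValRat.pow, padicValRat.pow, h2]
    at hv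
  have hd : (n : ℤ) ∣ 1 := ⟨padicValRat 2 q, by push_cast at hv; linarith⟩
  have := Int.le_of_dvd (by norm_num) hd
  omega

/-- Let `n ≥ 2`, `θ = 2^{1/n} ∈ ℝ` and `L = ℚ(θ)`.  Then `θ ∉ (L^*)ⁿℚ^*`: there are no
`a ∈ L^*`, `b ∈ ℚ^*` with `θ = aⁿ b`.  In particular `(L^*)ⁿℚ^* ≠ L^*`. -/
theorem nth_root_two_not_in_powers (n : ℕ) (hn : 2 ≤ n)
    (θ : ℝ) (hθ : θ = (2 : ℝ) ^ ((n : ℝ)⁻¹)) :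
    (¬ ∃ (a : IntermediateField.adjoin ℚ {θ}) (b : ℚ),
      a ≠ 0 ∧ b ≠ 0 ∧ ((a : ℝ) ^ n) * (b : ℝ) = θ) ∧
    {c : IntermediateField.adjoin ℚ {θ} |
        ∃ (a : IntermediateField.adjoin ℚ {θ}) (b : ℚ), a ≠ 0 ∧ b ≠ 0 ∧
          c = a ^ n * algebraMap ℚ (IntermediateField.adjoin ℚ {θ}) b} ≠
      {c : IntermediateField.adjoin ℚ {θ} | c ≠ 0} := by
  have hp : θ ^ n = 2 := by
    rw [hθ]
    exact Real.rpow_inv_natCast_pow (by norm_num) (by omega)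
  constructor
  · rintro ⟨a, b, -, -, h⟩
    apply aux_main n hn θ hp a b
    apply Subtype.ext
    simpa using h
  · intro h
    have h0 : IntermediateField.AdjoinSimple.gen ℚ θ ≠ 0 := by
      intro h0
      have h1 : θ = 0 := by simpa using congrArg Subtype.val h0
      rw [h1, zero_pow (by omega)] at hp
      norm_num at hp
    have h1 : IntermediateField.AdjoinSimple.gen ℚ θ ∈
      {c : IntermediateField.adjoin ℚ {θ} | c ≠ 0} := h0
    rw [← h] at h1
    obtain ⟨a, b, -, -, h2⟩ := h1
    exact aux_main n hn θ hp a b h2.symm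
end
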